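/- Let n ≥ 2. There exists a surjective F-algebra homomorphism β : D_F(B_{n+1}) → D_F(B_n) such that for every subset K ⊆ {0,…,n}: β(x_K) = x_{(K∖{0})−1} if 0 ∈ K, and β(x_K) = 0 if 0 ∉ K, where (K∖{0})−1 = {k−1 : k ∈ K, k ≠ 0} ⊆ {0,…,n−1}. -/

import Mathlib

set_option maxHeartbeats 1000000
set_option synthInstance.maxHeartbeats 1000000

/-- Coxeter matrix of type Bₙ, with the 4-bond between the simple reflections indexed 0 and 1,
and 3-bonds between consecutive indices. -/
def BMat (n : ℕ) : CoxeterMatrix (Fin n) where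
  M := Matrix.of fun i j : Fin n =>
    if i = j then 1
    else if min (i : ℕ) (j : ℕ) = 0 ∧ max (i : ℕ) (j : ℕ) = 1 then 4
    else if max (i : ℕ) (j : ℕ) = min (i : ℕ) (j : ℕ) + 1 then 3 else 2
  isSymm := by
    unfold Matrix.IsSymm
    ext i j
    simp only [Matrix.transpose_apply, Matrix.of_apply]
    rcases eq_or_ne i j with rfl | h
    · simp
    · rw [if_neg h, if_neg (Ne.symm h), min_comm (j : ℕ) (i : ℕ), max_comm (j : ℕ) (i : ℕ)]
  diagonal := by simp
  off_diagonal := by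
    intro i j h
    simp only [Matrix.of_apply, if_neg h]
    split_ifs <;> omega

/-- Coxeter matrix of type Dₙ: the simple reflections indexed 0 and 1 each have a 3-bond with
the one indexed 2, consecutive indices from 2 on have 3-bonds, and all other pairs commute. -/
def DMat (n : ℕ) : CoxeterMatrix (Fin n) where
  M := Matrix.of fun i j : Fin n =>
    if i = j then 1
    else if min (i : ℕ) (j : ℕ) = 0 ∧ max (i : ℕ) (j : ℕ) = 2 then 3
    else if 1 ≤ min (i : ℕ) (j : ℕ) ∧ max (i : ℕ) (j : ℕ) = min (i : ℕ) (j : ℕ) + 1 then 3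
    else 2
  isSymm := by
    unfold Matrix.IsSymm
    ext i j
    simp only [Matrix.transpose_apply, Matrix.of_apply]
    rcases eq_or_ne i j with rfl | h
    · simp
    · rw [if_neg h, if_neg (Ne.symm h), min_comm (j : ℕ) (i : ℕ), max_comm (j : ℕ) (i : ℕ)]
  diagonal := by simp
  off_diagonal := by
    intro i j h
    simp only [Matrix.of_apply, if_neg h]
    split_ifs <;> omega

open Classical in
/-- The element `x_J = ∑_{w ∈ X_J} w` of the group algebra, where
`X_J = {w : ℓ(w sᵢ) > ℓ(w) for all i ∈ J}`. -/
noncomputable def descentElt (F : Type*) [Field F] {B W : Type*} [Group W] [Fintype W]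
    {M : CoxeterMatrix B} (cs : CoxeterSystem M W) (J : Set B) : MonoidAlgebra F W :=
  ∑ w : W, if ∀ i ∈ J, cs.length w < cs.length (w * cs.simple i)
    then MonoidAlgebra.of F W w else 0

/-- The descent algebra: the `F`-subalgebra of the group algebra generated by the `x_J`. -/
noncomputable def descentAlgebra (F : Type*) [Field F] {B W : Type*} [Group W] [Fintype W]
    {M : CoxeterMatrix B} (cs : CoxeterSystem M W) : Subalgebra F (MonoidAlgebra F W) :=
  Algebra.adjoin F (Set.range (descentElt F cs))


/-! ### The signed permutation model -/

set_option linter.unusedSimpArgs false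

/-- The `i`-th simple reflection of type `B`, acting on `ℤ` by an odd permutation, with
offset `k`. -/
def sgnFun (k i : ℕ) (x : ℤ) : ℤ :=
  if i = 0 then (if x = k + 1 ∨ x = -(k + 1) then -x else x)
  else if x = k + i then x + 1 else if x = k + i + 1 then x - 1
  else if x = -(k + i) then x - 1 else if x = -(k + i + 1) then x + 1 else x

lemma sgnFun_invol (k i : ℕ) : Function.Involutive (sgnFun k i) := by
  intro x
  unfold sgnFun
  split_ifs <;> omega

/-- `sgnFun` as a permutation. -/
def sgnPerm (k i : ℕ) : Equiv.Perm ℤ := (sgnFun_invol k i).toPerm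

lemma sgnPerm_apply (k i : ℕ) (x : ℤ) : sgnPerm k i x = sgnFun k i x := rfl

lemma sgnFun_neg (k i : ℕ) (x : ℤ) : sgnFun k i (-x) = - sgnFun k i x := by
  unfold sgnFun
  split_ifs <;> omega

lemma sgnPerm_sq (k i : ℕ) : sgnPerm k i * sgnPerm k i = 1 := by
  ext x
  exact sgnFun_invol k i x

/-- No descent at `i`. -/
def Asc (k i : ℕ) (g : Equiv.Perm ℤ) : Prop :=
  if i = 0 then 0 < g (k + 1) else g (k + i) < g (k + i + 1)

lemma ev_fix0 {k : ℕ} {x : ℤ} (h1 : x ≠ k + 1) (h2 : x ≠ -(k + 1)) : sgnFun k 0 x = x := by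
  unfold sgnFun
  split_ifs <;> omega

lemma ev_fix {k i : ℕ} {x : ℤ} (hi : 1 ≤ i) (h1 : x ≠ k + i) (h2 : x ≠ k + i + 1)
    (h3 : x ≠ -(k + i)) (h4 : x ≠ -(k + i + 1)) : sgnFun k i x = x := by
  unfold sgnFun
  split_ifs <;> omega

lemma ev_zero {k : ℕ} {x : ℤ} (hx : x = k + 1) : sgnFun k 0 x = -(k + 1) := by
  simp [sgnFun, hx]

lemma ev_zero' {k : ℕ} {x : ℤ} (hx : x = -(k + 1)) : sgnFun k 0 x = k + 1 := by
  unfold sgnFun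
  split_ifs <;> omega

lemma ev1 {k i : ℕ} {x : ℤ} (h : 1 ≤ i) (hx : x = k + i) : sgnFun k i x = k + i + 1 := by
  unfold sgnFun
  split_ifs <;> omega

lemma ev2 {k i : ℕ} {x : ℤ} (h : 1 ≤ i) (hx : x = k + i + 1) : sgnFun k i x = k + i := by
  unfold sgnFun
  split_ifs <;> omega

lemma ev3 {k i : ℕ} {x : ℤ} (h : 1 ≤ i) (hx : x = -(k + i)) : sgnFun k i x = -(k + i + 1) := by
  unfold sgnFun
  split_ifs <;> omega

lemma ev4 {k i : ℕ} {x : ℤ} (h : 1 ≤ i) (hx : x = -(k + i + 1)) : sgnFun k i x = -(k + i) := by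
  unfold sgnFun
  split_ifs <;> omega

lemma sgn_comm (k i j : ℕ) (h : i + 2 ≤ j) :
    sgnPerm k i * sgnPerm k j = sgnPerm k j * sgnPerm k i := by
  ext x
  simp only [Equiv.Perm.mul_apply, sgnPerm_apply]
  by_cases h0 : i = 0
  · subst h0
    by_cases h1 : x = k + 1 ∨ x = -(k + 1) ∨ x = k + j ∨ x = k + j + 1 ∨ x = -(k + j) ∨
      x = -(k + j + 1)
    · rcases h1 with h1 | h1 | h1 | h1 | h1 | h1 <;>
        simp (disch := omega) only [ev_zero, ev_zero', ev1, ev2, ev3, ev4, ev_fix0, ev_fix]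
    · simp (disch := omega) only [ev_zero, ev_zero', ev1, ev2, ev3, ev4, ev_fix0, ev_fix]
  · by_cases h1 : x = k + i ∨ x = k + i + 1 ∨ x = -(k + i) ∨
      x = -(k + i + 1) ∨ x = k + j ∨ x = k + j + 1 ∨ x = -(k + j) ∨
      x = -(k + j + 1)
    · rcases h1 with h1 | h1 | h1 | h1 | h1 | h1 | h1 | h1 <;>
        simp (disch := omega) only [ev_zero, ev_zero', ev1, ev2, ev3, ev4, ev_fix0, ev_fix]
    · simp (disch := omega) only [ev_zero, ev_zero', ev1, ev2, ev3, ev4, ev_fix0, ev_fix]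

lemma sgn_braid3 (k i : ℕ) (h : 1 ≤ i) :
    sgnPerm k i * sgnPerm k (i + 1) * sgnPerm k i =
      sgnPerm k (i + 1) * sgnPerm k i * sgnPerm k (i + 1) := by
  ext x
  simp only [Equiv.Perm.mul_apply, sgnPerm_apply]
  by_cases h1 : x = k + i ∨ x = k + i + 1 ∨ x = k + i + 2 ∨
    x = -(k + i) ∨ x = -(k + i + 1) ∨ x = -(k + i + 2)
  · rcases h1 with h1 | h1 | h1 | h1 | h1 | h1 <;>
    · simp (disch := omega) only [ev_zero, ev_zero', ev1, ev2, ev3, ev4, ev_fix0, ev_fix]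
      try omega
  · simp (disch := omega) only [ev_zero, ev_zero', ev1, ev2, ev3, ev4, ev_fix0, ev_fix]

lemma sgn_braid4 (k : ℕ) :
    sgnPerm k 0 * sgnPerm k 1 * sgnPerm k 0 * sgnPerm k 1 =
      sgnPerm k 1 * sgnPerm k 0 * sgnPerm k 1 * sgnPerm k 0 := by
  ext x
  simp only [Equiv.Perm.mul_apply, sgnPerm_apply]
  by_cases h1 : x = k + 1 ∨ x = k + 2 ∨ x = -(k + 1) ∨ x = -(k + 2)
  · rcases h1 with h1 | h1 | h1 | h1 <;>
    · simp (disch := omega) only [ev_zero, ev_zero', ev1, ev2, ev3, ev4, ev_fix0, ev_fix]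
      try omega
  · simp (disch := omega) only [ev_zero, ev_zero', ev1, ev2, ev3, ev4, ev_fix0, ev_fix]

lemma pow2_of {G : Type*} [Group G] {a b : G} (ha : a * a = 1) (hb : b * b = 1) :
    (a * b) ^ 2 = 1 ↔ a * b = b * a := by
  have ha' : a⁻¹ = a := inv_eq_of_mul_eq_one_left ha
  have hb' : b⁻¹ = b := inv_eq_of_mul_eq_one_left hb
  rw [pow_two, mul_eq_one_iff_eq_inv, mul_inv_rev, ha', hb']

lemma pow3_of {G : Type*} [Group G] {a b : G} (ha : a * a = 1) (hb : b * b = 1) :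
    (a * b) ^ 3 = 1 ↔ a * b * a = b * a * b := by
  have ha' : a⁻¹ = a := inv_eq_of_mul_eq_one_left ha
  have hb' : b⁻¹ = b := inv_eq_of_mul_eq_one_left hb
  rw [show (a * b) ^ 3 = (a * b * a) * (b * a * b) by simp only [pow_succ, pow_zero, one_mul, mul_assoc], mul_eq_one_iff_eq_inv]
  simp only [mul_inv_rev, ha', hb', mul_assoc]

lemma pow4_of {G : Type*} [Group G] {a b : G} (ha : a * a = 1) (hb : b * b = 1) :
    (a * b) ^ 4 = 1 ↔ a * b * a * b = b * a * b * a := by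
  have ha' : a⁻¹ = a := inv_eq_of_mul_eq_one_left ha
  have hb' : b⁻¹ = b := inv_eq_of_mul_eq_one_left hb
  rw [show (a * b) ^ 4 = (a * b * a * b) * (a * b * a * b) by simp only [pow_succ, pow_zero, one_mul, mul_assoc], mul_eq_one_iff_eq_inv]
  simp only [mul_inv_rev, ha', hb', mul_assoc]

lemma BMat_apply (m : ℕ) (i j : Fin m) : BMat m i j = if i = j then 1
    else if min (i : ℕ) (j : ℕ) = 0 ∧ max (i : ℕ) (j : ℕ) = 1 then 4
    else if max (i : ℕ) (j : ℕ) = min (i : ℕ) (j : ℕ) + 1 then 3 else 2 := rfl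

lemma sgn_liftable (m k : ℕ) : (BMat m).IsLiftable (fun i : Fin m => sgnPerm k i) := by
  intro i j
  rw [BMat_apply]
  split_ifs with h1 h2 h3
  · subst h1
    rw [pow_one, sgnPerm_sq]
  · rw [pow4_of (sgnPerm_sq _ _) (sgnPerm_sq _ _)]
    rcases lt_or_ge (i : ℕ) (j : ℕ) with h | h
    · rw [show (i : ℕ) = 0 by omega, show (j : ℕ) = 1 by omega, sgn_braid4]
    · rw [show (i : ℕ) = 1 by omega, show (j : ℕ) = 0 by omega, sgn_braid4]
  · rw [pow3_of (sgnPerm_sq _ _) (sgnPerm_sq _ _)]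
    rcases lt_or_ge (i : ℕ) (j : ℕ) with h | h
    · rw [show (j : ℕ) = i + 1 by omega, sgn_braid3 _ _ (by omega)]
    · rw [show (i : ℕ) = j + 1 by omega, sgn_braid3 _ _ (by omega)]
  · rw [pow2_of (sgnPerm_sq _ _) (sgnPerm_sq _ _)]
    have : (i : ℕ) ≠ j := fun h => h1 (Fin.ext h)
    rcases lt_or_ge (i : ℕ) (j : ℕ) with h | h
    · rw [sgn_comm _ _ _ (by omega)]
    · rw [sgn_comm _ j i (by omega)]

section Model

variable {m : ℕ} {W : Type*} [Group W] (cs : CoxeterSystem (BMat m) W) (k : ℕ)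

/-- The signed permutation representation with offset `k`. -/
noncomputable def rep : W →* Equiv.Perm ℤ :=
  cs.lift ⟨fun i : Fin m => sgnPerm k i, sgn_liftable m k⟩

lemma rep_simple (i : Fin m) : rep cs k (cs.simple i) = sgnPerm k i :=
  cs.lift_apply_simple (sgn_liftable m k) i

lemma rep_odd (w : W) (x : ℤ) : rep cs k w (-x) = - rep cs k w x := by
  induction w using cs.simple_induction_left with
  | one => simp
  | mul_simple_left w i ih =>
    rw [map_mul, Equiv.Perm.mul_apply, ih, rep_simple, sgnPerm_apply, sgnFun_neg]; rfl

lemma asc_one (i : ℕ) : Asc k i 1 := by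
  unfold Asc; split_ifs
  · simp
  · simp

lemma asc_mul_self (g : Equiv.Perm ℤ) (hg : ∀ x, g (-x) = - g x) (i : ℕ) :
    Asc k i (g * sgnPerm k i) ↔ ¬ Asc k i g := by
  unfold Asc
  split_ifs with h
  · subst h
    have h0 : g (k + 1) ≠ 0 := by
      intro h0
      have h1 := hg (k + 1)
      rw [h0, neg_zero, ← h0] at h1
      have := g.injective h1
      omega
    simp only [Equiv.Perm.mul_apply, sgnPerm_apply, ev_zero, hg]
    omega
  · have h0 : g (k + i) ≠ g (k + i + 1) := fun h => by
      have := g.injective h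
      omega
    have e1 : sgnFun k i (k + i) = k + i + 1 := ev1 (by omega) rfl
    have e2 : sgnFun k i (k + i + 1) = k + i := ev2 (by omega) rfl
    simp only [Equiv.Perm.mul_apply, sgnPerm_apply, e1, e2]
    omega

lemma asc_zero (g : Equiv.Perm ℤ) : Asc k 0 g ↔ 0 < g (k + 1) := by simp [Asc]

lemma asc_pos (g : Equiv.Perm ℤ) {i : ℕ} (h : 1 ≤ i) :
    Asc k i g ↔ g (k + i) < g (k + i + 1) := by
  unfold Asc; rw [if_neg (by omega)]

end Model
section Model
variable {m : ℕ} {W : Type*} [Group W] (cs : CoxeterSystem (BMat m) W) (k : ℕ)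

lemma asc_mul1 (g : Equiv.Perm ℤ) (hg : ∀ x, g (-x) = - g x) (i j : ℕ) (hij : i ≠ j)
    (hi : Asc k i g) (hj : Asc k j g) : Asc k i (g * sgnPerm k j) := by
  rcases Nat.eq_zero_or_pos i with rfl | h
  · have hj1 : 1 ≤ j := by omega
    rw [asc_zero] at *
    rw [asc_pos _ _ hj1] at hj
    rw [Equiv.Perm.mul_apply, sgnPerm_apply]
    rcases Nat.eq_or_lt_of_le hj1 with rfl | h1
    · simp (disch := omega) only [ev_zero, ev_zero', ev1, ev2, ev3, ev4, ev_fix0, ev_fix, hg]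
      push_cast at *
      omega
    · simp (disch := omega) only [ev_zero, ev_zero', ev1, ev2, ev3, ev4, ev_fix0, ev_fix, hg]
      exact hi
  · rw [asc_pos _ _ h] at *
    simp only [Equiv.Perm.mul_apply, sgnPerm_apply]
    rcases Nat.eq_zero_or_pos j with rfl | hj1
    · rw [asc_zero] at hj
      rcases Nat.eq_or_lt_of_le h with rfl | h1
      · simp (disch := omega) only [ev_zero, ev_zero', ev1, ev2, ev3, ev4, ev_fix0, ev_fix, hg]
        push_cast at *
        omega
      · simp (disch := omega) only [ev_zero, ev_zero', ev1, ev2, ev3, ev4, ev_fix0, ev_fix, hg]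
        exact hi
    · rw [asc_pos _ _ hj1] at hj
      rcases lt_trichotomy j (i + 1) with h1 | h1 | h1
      · rcases Nat.eq_or_lt_of_le (show j + 1 ≤ i by omega) with h2 | h2
        · subst h2
          simp (disch := omega) only [ev_zero, ev_zero', ev1, ev2, ev3, ev4, ev_fix0, ev_fix, hg]
          push_cast at *
          simp only [← add_assoc] at *
          omega
        · simp (disch := omega) only [ev_zero, ev_zero', ev1, ev2, ev3, ev4, ev_fix0, ev_fix, hg]
          exact hi
      · subst h1
        simp (disch := omega) only [ev_zero, ev_zero', ev1, ev2, ev3, ev4, ev_fix0, ev_fix, hg]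
        push_cast at *
        simp only [← add_assoc] at *
        omega
      · simp (disch := omega) only [ev_zero, ev_zero', ev1, ev2, ev3, ev4, ev_fix0, ev_fix, hg]
        exact hi

lemma asc_mul2 (g : Equiv.Perm ℤ) (hg : ∀ x, g (-x) = - g x) (i j : ℕ)
    (hij : i = j + 1 ∨ j = i + 1)
    (hi : Asc k i g) (hj : Asc k j g) : Asc k i (g * sgnPerm k i * sgnPerm k j) := by
  rcases hij with rfl | rfl
  · rw [asc_pos k _ (show 1 ≤ j + 1 by omega)] at hi ⊢
    simp only [Equiv.Perm.mul_apply, sgnPerm_apply]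
    rcases Nat.eq_zero_or_pos j with rfl | hj1
    · rw [asc_zero] at hj
      simp (disch := omega) only [ev_zero, ev_zero', ev1, ev2, ev3, ev4, ev_fix0, ev_fix, hg]
      push_cast at *
      try simp only [← add_assoc, zero_add, add_zero] at *
      omega
    · rw [asc_pos _ _ hj1] at hj
      simp (disch := omega) only [ev_zero, ev_zero', ev1, ev2, ev3, ev4, ev_fix0, ev_fix, hg]
      push_cast at *
      simp only [← add_assoc] at *
      omega
  · rw [asc_pos _ _ (by omega)] at hj
    rcases Nat.eq_zero_or_pos i with rfl | hj1
    · rw [asc_zero] at *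
      simp only [Equiv.Perm.mul_apply, sgnPerm_apply]
      simp (disch := omega) only [ev_zero, ev_zero', ev1, ev2, ev3, ev4, ev_fix0, ev_fix, hg]
      push_cast at *
      try simp only [← add_assoc, zero_add, add_zero] at *
      omega
    · rw [asc_pos _ _ hj1] at *
      simp only [Equiv.Perm.mul_apply, sgnPerm_apply]
      simp (disch := omega) only [ev_zero, ev_zero', ev1, ev2, ev3, ev4, ev_fix0, ev_fix, hg]
      push_cast at *
      simp only [← add_assoc] at *
      omega

lemma asc_mul3 (g : Equiv.Perm ℤ) (hg : ∀ x, g (-x) = - g x) (i j : ℕ)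
    (hij : i = 0 ∧ j = 1 ∨ i = 1 ∧ j = 0)
    (hi : Asc k i g) (hj : Asc k j g) :
    Asc k i (g * sgnPerm k j * sgnPerm k i * sgnPerm k j) := by
  rcases hij with ⟨rfl, rfl⟩ | ⟨rfl, rfl⟩
  · rw [asc_zero] at *
    rw [asc_pos _ _ le_rfl] at hj
    simp only [Equiv.Perm.mul_apply, sgnPerm_apply]
    simp (disch := omega) only [ev_zero, ev_zero', ev1, ev2, ev3, ev4, ev_fix0, ev_fix, hg]
    push_cast at *
    omega
  · rw [asc_pos _ _ le_rfl] at *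
    rw [asc_zero] at hj
    simp only [Equiv.Perm.mul_apply, sgnPerm_apply]
    simp (disch := omega) only [ev_zero, ev_zero', ev1, ev2, ev3, ev4, ev_fix0, ev_fix, hg]
    push_cast at *
    omega

lemma tits (N : ℕ) : ∀ w : W, cs.length w = N → ∀ i : Fin m,
    cs.length w < cs.length (w * cs.simple i) → Asc k i (rep cs k w) := by
  induction N using Nat.strong_induction_on with
  | _ N ih =>
  intro w hw i hi
  by_cases h1 : w = 1
  · subst h1; rw [map_one]; exact asc_one k i
  obtain ⟨j, hj⟩ := cs.exists_rightDescent_of_ne_one h1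
  unfold CoxeterSystem.IsRightDescent at hj
  have hij : i ≠ j := by rintro rfl; omega
  have hij' : (i : ℕ) ≠ j := fun h => hij (Fin.ext h)
  -- a step down
  have key : ∀ (v : W) (a : Fin m), cs.length (v * cs.simple a) < cs.length v →
      cs.length (v * cs.simple a) + 1 = cs.length v ∧
      cs.length (v * cs.simple a) < cs.length (v * cs.simple a * cs.simple a) := by
    intro v a h
    have := cs.length_mul_simple v a
    rw [cs.simple_mul_simple_cancel_right]
    omega
  have hne : ∀ (v : W) (a : Fin m), ¬ cs.length v < cs.length (v * cs.simple a) →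
      cs.length (v * cs.simple a) < cs.length v := by
    intro v a h
    have := cs.length_mul_simple_ne v a
    omega
  have hle : ∀ (v : W) (a : Fin m), cs.length (v * cs.simple a) ≤ cs.length v + 1 := by
    intro v a
    have := cs.length_mul_simple v a
    omega
  have hM := cs.simple_mul_simple_pow i j
  have si := cs.simple_mul_simple_self i
  have sj := cs.simple_mul_simple_self j
  have hMv := BMat_apply m i j
  obtain ⟨l1, a1⟩ := key w j hj
  generalize e1 : w * cs.simple j = w1 at *
  have f1 : w = w1 * cs.simple j := by rw [← e1, cs.simple_mul_simple_cancel_right]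
  by_cases c1 : cs.length w1 < cs.length (w1 * cs.simple i)
  · rw [f1, map_mul, rep_simple]
    exact asc_mul1 k _ (rep_odd cs k w1) _ _ hij' (ih _ (by omega) w1 rfl i c1)
      (ih _ (by omega) w1 rfl j a1)
  obtain ⟨l2, a2⟩ := key w1 i (hne _ _ c1)
  generalize e2 : w1 * cs.simple i = w2 at *
  have f2 : w1 = w2 * cs.simple i := by rw [← e2, cs.simple_mul_simple_cancel_right]
  have n2 : (i : ℕ) = j + 1 ∨ (j : ℕ) = i + 1 := by
    by_contra hcon
    rw [if_neg hij, if_neg (by omega), if_neg (by omega)] at hMv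
    rw [hMv, pow2_of si sj] at hM
    have : w * cs.simple i = w2 * cs.simple j := by
      rw [f1, f2, mul_assoc w2, hM, ← mul_assoc, cs.simple_mul_simple_cancel_right]
    have h3 := hle w2 j
    rw [this] at hi
    omega
  by_cases c2 : cs.length w2 < cs.length (w2 * cs.simple j)
  · rw [f1, f2, map_mul, map_mul, rep_simple, rep_simple]
    exact asc_mul2 k _ (rep_odd cs k w2) _ _ n2 (ih _ (by omega) w2 rfl i a2)
      (ih _ (by omega) w2 rfl j c2)
  obtain ⟨l3, a3⟩ := key w2 j (hne _ _ c2)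
  generalize e3 : w2 * cs.simple j = w3 at *
  have f3 : w2 = w3 * cs.simple j := by rw [← e3, cs.simple_mul_simple_cancel_right]
  have n3 : (i : ℕ) = 0 ∧ (j : ℕ) = 1 ∨ (i : ℕ) = 1 ∧ (j : ℕ) = 0 := by
    by_contra hcon
    rw [if_neg hij, if_neg (by omega), if_pos (by omega)] at hMv
    rw [hMv, pow3_of si sj] at hM
    have : w * cs.simple i = w3 * cs.simple i * cs.simple j := by
      rw [f1, f2, f3]
      calc w3 * cs.simple j * cs.simple i * cs.simple j * cs.simple i
          = w3 * (cs.simple j * cs.simple i * cs.simple j) * cs.simple i := by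
            simp only [mul_assoc]
        _ = _ := by
            rw [← hM]
            simp only [mul_assoc, si, sj, mul_one]
            
    have h3 := hle (w3 * cs.simple i) j
    have h4 := hle w3 i
    rw [this] at hi
    omega
  by_cases c3 : cs.length w3 < cs.length (w3 * cs.simple i)
  · rw [f1, f2, f3, map_mul, map_mul, map_mul, rep_simple, rep_simple]
    exact asc_mul3 k _ (rep_odd cs k w3) _ _ n3 (ih _ (by omega) w3 rfl i c3)
      (ih _ (by omega) w3 rfl j a3)
  exfalso
  obtain ⟨l4, a4⟩ := key w3 i (hne _ _ c3)
  generalize e4 : w3 * cs.simple i = w4 at *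
  have f4 : w3 = w4 * cs.simple i := by rw [← e4, cs.simple_mul_simple_cancel_right]
  rw [if_neg hij, if_pos (by omega)] at hMv
  rw [hMv, pow4_of si sj] at hM
  have : w * cs.simple i = w4 * cs.simple j * cs.simple i * cs.simple j := by
    rw [f1, f2, f3, f4]
    calc w4 * cs.simple i * cs.simple j * cs.simple i * cs.simple j * cs.simple i
        = w4 * (cs.simple i * cs.simple j * cs.simple i * cs.simple j) * cs.simple i := by
          simp only [mul_assoc]
      _ = _ := by
          rw [hM]
          simp only [mul_assoc, si, sj, mul_one]
  have h3 := hle (w4 * cs.simple j * cs.simple i) j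
  have h4 := hle (w4 * cs.simple j) i
  have h5 := hle w4 j
  rw [this] at hi
  omega

/-- Descents are read off from the signed permutation. -/
lemma asc_iff (w : W) (i : Fin m) :
    cs.length w < cs.length (w * cs.simple i) ↔ Asc k i (rep cs k w) := by
  constructor
  · exact tits cs k _ w rfl i
  · intro h
    by_contra hc
    have hne := cs.length_mul_simple_ne w i
    have := tits cs k _ (w * cs.simple i) rfl i
      (by rw [cs.simple_mul_simple_cancel_right]; omega)
    rw [map_mul, rep_simple, asc_mul_self k _ (rep_odd cs k w)] at this
    exact this h

lemma rep_inj : Function.Injective (rep cs k) := by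
  rw [injective_iff_map_eq_one]
  intro w hw
  by_contra h1
  obtain ⟨j, hj⟩ := cs.exists_rightDescent_of_ne_one h1
  unfold CoxeterSystem.IsRightDescent at hj
  have := (asc_iff cs k w j).2 (by rw [hw]; exact asc_one k j)
  omega

end Model
section Embedding

variable {n : ℕ} {W₁ : Type*} [Group W₁] (cs₁ : CoxeterSystem (BMat (n + 1)) W₁)
  {W₂ : Type*} [Group W₂] (cs₂ : CoxeterSystem (BMat n) W₂)

lemma sgn_shift0 : sgnPerm 1 0 = sgnPerm 0 1 * sgnPerm 0 0 * sgnPerm 0 1 := by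
  ext x
  simp only [Equiv.Perm.mul_apply, sgnPerm_apply]
  by_cases h1 : x = 1 ∨ x = 2 ∨ x = -1 ∨ x = -2
  · rcases h1 with h1 | h1 | h1 | h1 <;> subst h1 <;> decide
  · simp (disch := omega) only [ev_zero, ev_zero', ev1, ev2, ev3, ev4, ev_fix0, ev_fix]

lemma sgn_shift (j : ℕ) (hj : 1 ≤ j) : sgnPerm 1 j = sgnPerm 0 (j + 1) := by
  ext x
  simp only [sgnPerm_apply]
  unfold sgnFun
  push_cast
  split_ifs <;> omega

/-- The second representation lands in the image of the first. -/
lemma exists_phi (v : W₂) : ∃ u : W₁, rep cs₁ 0 u = rep cs₂ 1 v := by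
  induction v using cs₂.simple_induction_left with
  | one => exact ⟨1, by simp⟩
  | mul_simple_left w j ih =>
    obtain ⟨u, hu⟩ := ih
    rcases Nat.eq_zero_or_pos (j : ℕ) with h | h
    · refine ⟨cs₁.simple j.succ * cs₁.simple 0 * cs₁.simple j.succ * u, ?_⟩
      simp only [map_mul, rep_simple, hu, Fin.val_succ, h, Fin.val_zero, zero_add]
      rw [sgn_shift0]
    · refine ⟨cs₁.simple j.succ * u, ?_⟩
      simp only [map_mul, rep_simple, hu, Fin.val_succ]
      rw [sgn_shift _ h]

lemma psi_one (v : W₂) : rep cs₂ 1 v 1 = 1 := by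
  induction v using cs₂.simple_induction_left with
  | one => simp
  | mul_simple_left w j ih =>
    rw [map_mul, Equiv.Perm.mul_apply, ih, rep_simple, sgnPerm_apply]
    rcases Nat.eq_zero_or_pos (j : ℕ) with h | h
    · rw [h]; decide
    · exact ev_fix h (by push_cast; omega) (by push_cast; omega) (by push_cast; omega)
        (by push_cast; omega)

lemma asc_shift (g : Equiv.Perm ℤ) (hg : g 1 = 1) (j : ℕ) : Asc 1 j g ↔ Asc 0 (j + 1) g := by
  rw [asc_pos 0 g (show 1 ≤ j + 1 by omega)]
  rcases Nat.eq_zero_or_pos j with rfl | h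
  · rw [asc_zero]
    have h2 : g 2 ≠ 1 := fun h => by
      rw [← hg] at h
      have := g.injective h
      omega
    norm_num [hg]
    omega
  · rw [asc_pos 1 g h]
    push_cast
    rw [show (1 : ℤ) + j = 0 + (j + 1) by ring]

lemma exists_psi_aux (N : ℕ) : ∀ u : W₁, cs₁.length u = N → rep cs₁ 0 u 1 = 1 →
    ∃ v : W₂, rep cs₂ 1 v = rep cs₁ 0 u := by
  induction N using Nat.strong_induction_on with
  | _ N ih =>
  intro u hu h1
  by_cases hu1 : u = 1
  · exact ⟨1, by rw [hu1]; simp⟩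
  obtain ⟨i, hi⟩ := cs₁.exists_rightDescent_of_ne_one hu1
  unfold CoxeterSystem.IsRightDescent at hi
  have hna : ¬ Asc 0 i (rep cs₁ 0 u) := by
    rw [← asc_iff]; omega
  induction i using Fin.cases with
  | zero =>
    exfalso
    apply hna
    rw [Fin.val_zero, asc_zero]
    simp [h1]
  | succ j =>
    rcases Nat.eq_zero_or_pos (j : ℕ) with h | h
    · have hS : rep cs₁ 0 (cs₁.simple j.succ) = sgnPerm 0 1 := by
        rw [rep_simple, Fin.val_succ, h]
      have h0 : rep cs₁ 0 (cs₁.simple 0) = sgnPerm 0 0 := rep_simple _ _ _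
      have odd := rep_odd cs₁ 0 u
      set g := rep cs₁ 0 u with hgdef
      have g2 : g 2 < 0 := by
        rw [Fin.val_succ, h, asc_pos _ _ (by omega)] at hna
        norm_num [h1] at hna
        have h2 : g 2 ≠ 0 := fun h => by
          have e := odd 2
          rw [h, neg_zero, ← h] at e
          have := g.injective e
          omega
        have h3 : g 2 ≠ 1 := fun h => by
          rw [← h1] at h
          have := g.injective h
          omega
        omega
      have g3 : g 2 ≠ -1 := fun h => by
        have e := odd 1
        rw [h1, ← h] at e
        have := g.injective e
        omega
      -- the second step down
      have d2 : cs₁.length (u * cs₁.simple j.succ * cs₁.simple 0) <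
          cs₁.length (u * cs₁.simple j.succ) := by
        have := cs₁.length_mul_simple_ne (u * cs₁.simple j.succ) 0
        have h5 : ¬ (cs₁.length (u * cs₁.simple j.succ) <
          cs₁.length (u * cs₁.simple j.succ * cs₁.simple 0)) := by
          rw [asc_iff cs₁ 0, map_mul, hS, Fin.val_zero, asc_zero, ← hgdef]
          simp only [Equiv.Perm.mul_apply, sgnPerm_apply]
          simp (disch := omega) only [ev1]
          norm_num
          omega
        omega
      have d3 : cs₁.length (u * cs₁.simple j.succ * cs₁.simple 0 * cs₁.simple j.succ) <
          cs₁.length (u * cs₁.simple j.succ * cs₁.simple 0) := by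
        have := cs₁.length_mul_simple_ne (u * cs₁.simple j.succ * cs₁.simple 0) j.succ
        have h5 : ¬ (cs₁.length (u * cs₁.simple j.succ * cs₁.simple 0) <
          cs₁.length (u * cs₁.simple j.succ * cs₁.simple 0 * cs₁.simple j.succ)) := by
          rw [asc_iff cs₁ 0, map_mul, map_mul, hS, h0, Fin.val_succ, h, asc_pos _ _ (by omega),
            ← hgdef]
          simp only [Equiv.Perm.mul_apply, sgnPerm_apply]
          rw [show sgnFun 0 0 ((0 : ℕ) + (0 + 1 : ℕ)) = -1 by decide,
            show sgnFun 0 0 ((0 : ℕ) + (0 + 1 : ℕ) + 1) = 2 by decide,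
            show sgnFun 0 1 (-1) = -2 by decide, show sgnFun 0 1 2 = 1 by decide, odd, h1]
          omega
        omega
      have hfin : rep cs₁ 0 (u * cs₁.simple j.succ * cs₁.simple 0 * cs₁.simple j.succ) =
          g * sgnPerm 1 0 := by
        rw [sgn_shift0, map_mul, map_mul, map_mul, hS, h0, ← hgdef]
        simp only [mul_assoc]
      obtain ⟨v, hv⟩ := ih _ (by omega)
        (u * cs₁.simple j.succ * cs₁.simple 0 * cs₁.simple j.succ) rfl (by
          rw [hfin, Equiv.Perm.mul_apply, sgnPerm_apply,
            show sgnFun 1 0 1 = 1 by decide, h1])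
      refine ⟨v * cs₂.simple j, ?_⟩
      rw [map_mul, hv, hfin, rep_simple, h, mul_assoc, sgnPerm_sq, mul_one]
    · have hS : rep cs₁ 0 (cs₁.simple j.succ) = sgnPerm 1 j := by
        rw [rep_simple, Fin.val_succ, sgn_shift _ h]
      obtain ⟨v, hv⟩ := ih _ (by omega) (u * cs₁.simple j.succ) rfl (by
        rw [map_mul, hS, Equiv.Perm.mul_apply, sgnPerm_apply, ev_fix h, h1] <;> push_cast <;>
          omega)
      refine ⟨v * cs₂.simple j, ?_⟩
      rw [map_mul, hv, map_mul, hS, rep_simple, mul_assoc, sgnPerm_sq, mul_one]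

/-- The embedding of the smaller group. -/
noncomputable def emb : W₂ →* W₁ where
  toFun v := (exists_phi cs₁ cs₂ v).choose
  map_one' := rep_inj cs₁ 0 (by rw [(exists_phi cs₁ cs₂ 1).choose_spec]; simp)
  map_mul' v w := rep_inj cs₁ 0 (by
    rw [(exists_phi cs₁ cs₂ (v * w)).choose_spec, map_mul, map_mul,
      (exists_phi cs₁ cs₂ v).choose_spec, (exists_phi cs₁ cs₂ w).choose_spec])

lemma rep_emb (v : W₂) : rep cs₁ 0 (emb cs₁ cs₂ v) = rep cs₂ 1 v :=
  (exists_phi cs₁ cs₂ v).choose_spec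

lemma emb_inj : Function.Injective (emb cs₁ cs₂) := fun v w h => by
  apply rep_inj cs₂ 1
  rw [← rep_emb cs₁ cs₂, h, rep_emb]

lemma mem_range_emb {u : W₁} (h : rep cs₁ 0 u 1 = 1) : u ∈ Set.range (emb cs₁ cs₂) := by
  obtain ⟨v, hv⟩ := exists_psi_aux cs₁ cs₂ _ u rfl h
  exact ⟨v, rep_inj cs₁ 0 (by rw [rep_emb, hv])⟩

lemma flip_apply (x : ℤ) : sgnPerm 0 0 x = if x = 1 ∨ x = -1 then -x else x := by
  simp [sgnPerm_apply, sgnFun]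

lemma emb_comm (v : W₂) : cs₁.simple 0 * emb cs₁ cs₂ v = emb cs₁ cs₂ v * cs₁.simple 0 := by
  apply rep_inj cs₁ 0
  have h1 := psi_one cs₂ v
  have odd := rep_odd cs₂ 1 v
  rw [map_mul, map_mul, rep_emb, rep_simple, Fin.val_zero]
  set g := rep cs₂ 1 v
  have hm1 : g (-1) = -1 := by rw [odd, h1]
  ext x
  simp only [Equiv.Perm.mul_apply, flip_apply]
  by_cases hx : x = 1
  · subst hx; simp [h1, hm1]
  by_cases hx' : x = -1
  · subst hx'; simp [h1, hm1]
  have e1 : g x ≠ 1 := fun h => hx (g.injective (h.trans h1.symm))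
  have e2 : g x ≠ -1 := fun h => hx' (g.injective (h.trans hm1.symm))
  simp [hx, hx', e1, e2]

/-- `u` has no descent at `i`. -/
abbrev AscW (u : W₁) (i : Fin (n + 1)) : Prop := cs₁.length u < cs₁.length (u * cs₁.simple i)

lemma flip_succ (u : W₁) (j : Fin n) :
    AscW cs₁ (cs₁.simple 0 * u) j.succ ↔ AscW cs₁ u j.succ := by
  unfold AscW
  rw [asc_iff cs₁ 0, asc_iff cs₁ 0, map_mul, rep_simple, Fin.val_zero]
  have odd := rep_odd cs₁ 0 u
  set g := rep cs₁ 0 u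
  rw [Fin.val_succ, asc_pos _ _ (by omega), asc_pos _ _ (by omega)]
  simp only [Equiv.Perm.mul_apply, flip_apply]
  set x : ℤ := (0 : ℕ) + ((j : ℕ) + 1 : ℕ) with hx
  have hx1 : 1 ≤ x := by omega
  have n0 : ∀ y : ℤ, y ≠ 0 → g y ≠ 0 := fun y hy h => by
    have e := odd y
    rw [h, neg_zero, ← h] at e
    have := g.injective e
    omega
  have a1 := n0 x (by omega)
  have a2 := n0 (x + 1) (by omega)
  have a3 : g x ≠ g (x + 1) := fun h => by
    have := g.injective h
    omega
  have a4 : g x ≠ - g (x + 1) := fun h => by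
    rw [← odd] at h
    have := g.injective h
    omega
  split_ifs <;> omega

lemma asc_zero_iff (u : W₁) : AscW cs₁ u 0 ↔ 0 < rep cs₁ 0 u 1 := by
  unfold AscW
  rw [asc_iff cs₁ 0, Fin.val_zero, asc_zero]
  norm_num

lemma rep_flip (u : W₁) : rep cs₁ 0 (cs₁.simple 0 * u) 1 =
    if rep cs₁ 0 u 1 = 1 ∨ rep cs₁ 0 u 1 = -1 then - rep cs₁ 0 u 1 else rep cs₁ 0 u 1 := by
  rw [map_mul, rep_simple, Fin.val_zero, Equiv.Perm.mul_apply, flip_apply]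

lemma asc_emb (v : W₂) (j : Fin n) : AscW cs₁ (emb cs₁ cs₂ v) j.succ ↔
    cs₂.length v < cs₂.length (v * cs₂.simple j) := by
  unfold AscW
  rw [asc_iff cs₁ 0, asc_iff cs₂ 1, rep_emb, Fin.val_succ, asc_shift _ (psi_one cs₂ v)]

end Embedding
section AlgebraPart

variable {F : Type*} [Field F]

lemma coeff_mul_fintype {W : Type*} [Group W] [Fintype W] (x d : MonoidAlgebra F W) (w : W) :
    (x * d).coeff w = ∑ u : W, x.coeff u * d.coeff (u⁻¹ * w) := by
  classical
  rw [MonoidAlgebra.coeff_mul, Finsupp.sum_fintype _ _ (by simp)]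
  refine Finset.sum_congr rfl fun u _ => ?_
  rw [Finsupp.sum_fintype _ _ (by simp), Finset.sum_eq_single (u⁻¹ * w)]
  · simp
  · intro b _ hb
    rw [if_neg]
    rintro rfl
    simp at hb
  · simp

open Classical in
lemma coeff_descentElt {B W : Type*} [Group W] [Fintype W] {M : CoxeterMatrix B}
    (cs : CoxeterSystem M W) (J : Set B) (u : W) :
    (descentElt F cs J).coeff u =
      if ∀ i ∈ J, cs.length u < cs.length (u * cs.simple i) then 1 else 0 := by
  unfold descentElt
  rw [MonoidAlgebra.coeff_sum, Finsupp.finsetSum_apply, Finset.sum_eq_single u]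
  · split_ifs <;> simp
  · intro w _ hw
    split_ifs <;> simp [hw]
  · simp

variable {W₁ W₂ : Type*} [Group W₁] [Fintype W₁] [Group W₂] [Fintype W₂]

/-- The linear map inducing `β`. -/
noncomputable def piMap (F : Type*) [Field F] {W₁ W₂ : Type*} [Group W₁] [Group W₂] [Fintype W₂]
    (e : W₂ →* W₁) (s : W₁) :
    MonoidAlgebra F W₁ →ₗ[F] MonoidAlgebra F W₂ where
  toFun f := .ofCoeff (Finsupp.equivFunOnFinite.symm
    fun v => f.coeff (e v) - f.coeff (e v * s))
  map_add' f g := by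
    ext v
    simp
    ring
  map_smul' r f := by
    ext v
    simp
    ring

lemma coeff_piMap (e : W₂ →* W₁) (s : W₁) (f : MonoidAlgebra F W₁) (v : W₂) :
    (piMap F e s f).coeff v = f.coeff (e v) - f.coeff (e v * s) := rfl

lemma piMap_mul (e : W₂ →* W₁) (he : Function.Injective e) (s : W₁) (hs : s * s = 1)
    (hc : ∀ v, s * e v = e v * s) (x : MonoidAlgebra F W₁) (x' : MonoidAlgebra F W₂)
    (a : W₁ → F) (hb : ∀ u, x.coeff (s * u) - a (s * u) = x.coeff u - a u)
    (ha : ∀ u, u ∉ Set.range e → a u = 0) (ha' : ∀ v, x'.coeff v = a (e v))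
    (d : MonoidAlgebra F W₁) :
    piMap F e s (x * d) = x' * piMap F e s d := by
  have hs' : s⁻¹ = s := inv_eq_of_mul_eq_one_left hs
  ext v
  rw [coeff_piMap, coeff_mul_fintype, coeff_mul_fintype, coeff_mul_fintype]
  have hR : ∑ u, x'.coeff u * (piMap F e s d).coeff (u⁻¹ * v) =
      ∑ u, a u * (d.coeff (u⁻¹ * e v) - d.coeff (u⁻¹ * (e v * s))) := by
    apply Fintype.sum_of_injective e he
    · intro u hu
      rw [ha u hu, zero_mul]
    · intro u
      rw [coeff_piMap, ha', map_mul, map_inv, mul_assoc]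
  have h0 : ∑ u, (x.coeff u - a u) * d.coeff (u⁻¹ * e v) =
      ∑ u, (x.coeff u - a u) * d.coeff (u⁻¹ * (e v * s)) := by
    apply Fintype.sum_equiv (Equiv.mulLeft s)
    intro u
    rw [Equiv.coe_mulLeft, hb, mul_inv_rev, hs', ← hc, mul_assoc, ← mul_assoc s s, hs, one_mul]
  rw [hR]
  have h1 : ∀ y : W₁, ∑ u, x.coeff u * d.coeff (u⁻¹ * y) =
      ∑ u, (x.coeff u - a u) * d.coeff (u⁻¹ * y) + ∑ u, a u * d.coeff (u⁻¹ * y) := by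
    intro y
    rw [← Finset.sum_add_distrib]
    exact Finset.sum_congr rfl fun u _ => by ring
  rw [h1, h1, h0]
  simp only [mul_sub, Finset.sum_sub_distrib]
  ring

end AlgebraPart

section Final

variable {F : Type*} [Field F] {n : ℕ}
  {W₁ : Type*} [Group W₁] [Fintype W₁] (cs₁ : CoxeterSystem (BMat (n + 1)) W₁)
  {W₂ : Type*} [Group W₂] [Fintype W₂] (cs₂ : CoxeterSystem (BMat n) W₂)

/-- The linear map inducing `β`, for the two Coxeter systems. -/
noncomputable def pim (F : Type*) [Field F] {n : ℕ}
    {W₁ : Type*} [Group W₁] (cs₁ : CoxeterSystem (BMat (n + 1)) W₁)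
    {W₂ : Type*} [Group W₂] [Fintype W₂] (cs₂ : CoxeterSystem (BMat n) W₂) :
    MonoidAlgebra F W₁ →ₗ[F] MonoidAlgebra F W₂ :=
  piMap F (emb cs₁ cs₂) (cs₁.simple 0)

lemma pim_one : pim F cs₁ cs₂ 1 = 1 := by
  classical
  ext v
  have h1 : emb cs₁ cs₂ v * cs₁.simple 0 ≠ 1 := by
    intro h
    have h2 := rep_flip cs₁ (emb cs₁ cs₂ v)
    rw [emb_comm, h, rep_emb, psi_one] at h2
    norm_num at h2
  have h3 : emb cs₁ cs₂ v = 1 ↔ v = 1 := by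
    rw [← map_one (emb cs₁ cs₂)]
    exact (emb_inj cs₁ cs₂).eq_iff
  unfold pim
  rw [coeff_piMap]
  simp only [MonoidAlgebra.one_def, MonoidAlgebra.coeff_single, Finsupp.single_apply]
  simp only [eq_comm (a := (1 : W₁)), eq_comm (a := (1 : W₂)), h1, h3, if_false, sub_zero]

lemma forall_K (K : Set (Fin (n + 1))) (p : Fin (n + 1) → Prop) :
    (∀ i ∈ K, p i) ↔ ((0 ∈ K → p 0) ∧ ∀ j : Fin n, j.succ ∈ K → p j.succ) := by
  rw [Fin.forall_fin_succ]

lemma pim_mul_zero (K : Set (Fin (n + 1))) (h : 0 ∉ K) (d : MonoidAlgebra F W₁) :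
    pim F cs₁ cs₂ (descentElt F cs₁ K * d) = 0 := by
  classical
  have := piMap_mul (emb cs₁ cs₂) (emb_inj cs₁ cs₂) (cs₁.simple 0)
    (cs₁.simple_mul_simple_self 0) (emb_comm cs₁ cs₂) (descentElt F cs₁ K) 0 (fun _ => 0)
    (by
      intro u
      simp only [coeff_descentElt, sub_zero]
      congr 1
      rw [forall_K, forall_K]
      simp only [h, false_imp_iff, true_and]
      exact propext (forall_congr' fun j => imp_congr_right fun _ => flip_succ cs₁ u j))
    (fun _ _ => rfl) (fun _ => rfl) d
  rw [zero_mul] at this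
  exact this

lemma pim_mul_mem (K : Set (Fin (n + 1))) (h : 0 ∈ K) (d : MonoidAlgebra F W₁) :
    pim F cs₁ cs₂ (descentElt F cs₁ K * d) =
      descentElt F cs₂ {j : Fin n | j.succ ∈ K} * pim F cs₁ cs₂ d := by
  classical
  have hz : ∀ u : W₁, rep cs₁ 0 u 1 = -1 → (descentElt F cs₁ K).coeff u = 0 := by
    intro u hu
    rw [coeff_descentElt, if_neg]
    intro hall
    have h2 := (asc_zero_iff cs₁ u).1 (hall 0 h)
    omega
  refine piMap_mul (emb cs₁ cs₂) (emb_inj cs₁ cs₂) (cs₁.simple 0)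
    (cs₁.simple_mul_simple_self 0) (emb_comm cs₁ cs₂) (descentElt F cs₁ K) _
    (fun u => if rep cs₁ 0 u 1 = 1 then (descentElt F cs₁ K).coeff u else 0) ?_ ?_ ?_ d
  · intro u
    have hf := rep_flip cs₁ u
    by_cases c1 : rep cs₁ 0 u 1 = 1
    · rw [if_pos (Or.inl c1), c1] at hf
      simp [hf, c1, hz _ hf]
    by_cases c2 : rep cs₁ 0 u 1 = -1
    · rw [if_pos (Or.inr c2), c2] at hf
      rw [neg_neg] at hf
      simp only [hf, hz _ c2, c1, if_true, if_false, sub_self, sub_zero]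
    rw [if_neg (by tauto)] at hf
    simp only [hf, c1, if_false, sub_zero]
    rw [coeff_descentElt, coeff_descentElt]
    congr 1
    rw [forall_K, forall_K]
    have e0 : AscW cs₁ (cs₁.simple 0 * u) 0 ↔ AscW cs₁ u 0 := by
      rw [asc_zero_iff, asc_zero_iff, hf]
    exact propext (and_congr (imp_congr_right fun _ => e0)
      (forall_congr' fun j => imp_congr_right fun _ => flip_succ cs₁ u j))
  · intro u hu
    exact if_neg fun hc => hu (mem_range_emb cs₁ cs₂ hc)
  · intro v
    have h1 : rep cs₁ 0 (emb cs₁ cs₂ v) 1 = 1 := by rw [rep_emb, psi_one]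
    simp only [h1, if_true]
    rw [coeff_descentElt, coeff_descentElt]
    congr 1
    rw [forall_K]
    have e0 : AscW cs₁ (emb cs₁ cs₂ v) 0 := by
      rw [asc_zero_iff, h1]; norm_num
    apply propext
    constructor
    · intro hall
      exact ⟨fun _ => e0, fun j hj => (asc_emb cs₁ cs₂ v j).2 (hall j hj)⟩
    · intro hall j hj
      exact (asc_emb cs₁ cs₂ v j).1 (hall.2 j hj)

lemma pim_zero (K : Set (Fin (n + 1))) (h : 0 ∉ K) :
    pim F cs₁ cs₂ (descentElt F cs₁ K) = 0 := by
  rw [← pim_mul_zero cs₁ cs₂ K h 1, mul_one]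

lemma pim_mem (K : Set (Fin (n + 1))) (h : 0 ∈ K) :
    pim F cs₁ cs₂ (descentElt F cs₁ K) = descentElt F cs₂ {j : Fin n | j.succ ∈ K} := by
  have := pim_mul_mem cs₁ cs₂ K h (1 : MonoidAlgebra F W₁)
  rwa [mul_one, pim_one, mul_one] at this

lemma pim_algebraMap (r : F) : pim F cs₁ cs₂ (algebraMap F _ r) = algebraMap F _ r := by
  rw [Algebra.algebraMap_eq_smul_one, map_smul, pim_one, Algebra.algebraMap_eq_smul_one]

lemma pim_mul {x : MonoidAlgebra F W₁} (hx : x ∈ descentAlgebra F cs₁) :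
    ∀ d, pim F cs₁ cs₂ (x * d) = pim F cs₁ cs₂ x * pim F cs₁ cs₂ d := by
  induction hx using Algebra.adjoin_induction with
  | mem x hx =>
    intro d
    obtain ⟨K, rfl⟩ := hx
    by_cases h : 0 ∈ K
    · rw [pim_mul_mem cs₁ cs₂ K h, pim_mem cs₁ cs₂ K h]
    · rw [pim_mul_zero cs₁ cs₂ K h, pim_zero cs₁ cs₂ K h, zero_mul]
  | algebraMap r =>
    intro d
    rw [pim_algebraMap, ← Algebra.smul_def, ← Algebra.smul_def, map_smul]
  | add x y _ _ hx hy => intro d; rw [add_mul, map_add, hx, hy, map_add, add_mul]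
  | mul x y _ _ hx hy => intro d; rw [mul_assoc, hx, hy, hx, mul_assoc]

lemma pim_range {x : MonoidAlgebra F W₁} (hx : x ∈ descentAlgebra F cs₁) :
    pim F cs₁ cs₂ x ∈ descentAlgebra F cs₂ := by
  induction hx using Algebra.adjoin_induction with
  | mem x hx =>
    obtain ⟨K, rfl⟩ := hx
    by_cases h : 0 ∈ K
    · rw [pim_mem cs₁ cs₂ K h]
      exact Algebra.subset_adjoin (Set.mem_range_self _)
    · rw [pim_zero cs₁ cs₂ K h]
      exact zero_mem _
  | algebraMap r => rw [pim_algebraMap]; exact Subalgebra.algebraMap_mem _ r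
  | add x y _ _ hx hy => rw [map_add]; exact add_mem hx hy
  | mul x y hx' _ hx hy => rw [pim_mul cs₁ cs₂ hx']; exact mul_mem hx hy

lemma pim_surj {y : MonoidAlgebra F W₂} (hy : y ∈ descentAlgebra F cs₂) :
    ∃ x ∈ descentAlgebra F cs₁, pim F cs₁ cs₂ x = y := by
  induction hy using Algebra.adjoin_induction with
  | mem y hy =>
    obtain ⟨J, rfl⟩ := hy
    refine ⟨descentElt F cs₁ (insert 0 (Fin.succ '' J)),
      Algebra.subset_adjoin (Set.mem_range_self _), ?_⟩
    rw [pim_mem cs₁ cs₂ _ (Set.mem_insert _ _)]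
    congr 1
    ext j
    simp [Fin.succ_ne_zero]
  | algebraMap r => exact ⟨_, Subalgebra.algebraMap_mem _ r, pim_algebraMap cs₁ cs₂ r⟩
  | add y z _ _ hy hz =>
    obtain ⟨a, ha, rfl⟩ := hy
    obtain ⟨b, hb, rfl⟩ := hz
    exact ⟨a + b, add_mem ha hb, map_add _ _ _⟩
  | mul y z _ _ hy hz =>
    obtain ⟨a, ha, rfl⟩ := hy
    obtain ⟨b, hb, rfl⟩ := hz
    exact ⟨a * b, mul_mem ha hb, pim_mul cs₁ cs₂ ha b⟩

end Final

/-- (Aguiar–Bergeron–Nyman) There is a surjective `F`-algebra homomorphism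
`β : D_F(B_{n+1}) → D_F(B_n)` with `β(x_K) = x_{(K∖{0})−1}` if `0 ∈ K` and `β(x_K) = 0`
otherwise. -/
theorem stmt_13 (F : Type*) [Field F] (n : ℕ) (hn : 2 ≤ n)
    (W₁ : Type*) [Group W₁] [Fintype W₁] (cs₁ : CoxeterSystem (BMat (n + 1)) W₁)
    (W₂ : Type*) [Group W₂] [Fintype W₂] (cs₂ : CoxeterSystem (BMat n) W₂) :
    ∃ β : ↥(descentAlgebra F cs₁) →ₐ[F] ↥(descentAlgebra F cs₂),
      Function.Surjective β ∧
      ∀ K : Set (Fin (n + 1)),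
        ((0 : Fin (n + 1)) ∈ K →
          (β ⟨descentElt F cs₁ K, Algebra.subset_adjoin (Set.mem_range_self K)⟩ :
              MonoidAlgebra F W₂) =
            descentElt F cs₂ {j : Fin n | j.succ ∈ K}) ∧
        ((0 : Fin (n + 1)) ∉ K →
          β ⟨descentElt F cs₁ K, Algebra.subset_adjoin (Set.mem_range_self K)⟩ = 0) := by
  let γ : ↥(descentAlgebra F cs₁) →ₐ[F] MonoidAlgebra F W₂ :=
    AlgHom.ofLinearMap ((pim F cs₁ cs₂).comp (descentAlgebra F cs₁).val.toLinearMap)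
      (pim_one cs₁ cs₂) (fun x y => pim_mul cs₁ cs₂ x.2 y)
  have hγ : ∀ x, γ x = pim F cs₁ cs₂ x := fun x => rfl
  refine ⟨γ.codRestrict (descentAlgebra F cs₂) (fun x => pim_range cs₁ cs₂ x.2), ?_, ?_⟩
  · rintro ⟨y, hy⟩
    obtain ⟨x, hx, rfl⟩ := pim_surj cs₁ cs₂ hy
    exact ⟨⟨x, hx⟩, Subtype.ext rfl⟩
  · intro K
    exact ⟨fun h => pim_mem cs₁ cs₂ K h, fun h => Subtype.ext (pim_zero cs₁ cs₂ K h)⟩
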